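/- arXiv:2404.09396 — 2 statements merged into one kernel-verified Lean document; each statement's English description precedes it below -/
import Mathlib

section
/- Let G be a cograph and consider the twin equivalence relation on its vertices: u ∼ v if and only if u = v, or N(u) = N(v), or N[u] = N[v]. If this relation has exactly r equivalence classes, then G has at most r main Q-eigenvalues. -/
open SimpleGraph

/-- The signless Laplacian matrix `Q(G) = D(G) + A(G)` of a finite simple graph. -/
noncomputable def signlessLaplacian {V : Type*} [Fintype V] (G : SimpleGraph V) :
    Matrix V V ℝ :=
  letI := Classical.decEq V
  letI := Classical.decRel G.Adj
  Matrix.diagonal (fun v => (G.degree v : ℝ)) + G.adjMatrix ℝ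

/-- `q` is a main Q-eigenvalue of `G`: some eigenvector of `Q(G)` for `q`
has nonzero entry sum. -/
def IsMainQEigenvalue {V : Type*} [Fintype V] (G : SimpleGraph V) (q : ℝ) : Prop :=
  ∃ x : V → ℝ, (signlessLaplacian G).mulVec x = q • x ∧ (∑ v, x v) ≠ 0

/-- The number of (distinct) main Q-eigenvalues of `G`. -/
noncomputable def mainQCount {V : Type*} [Fintype V] (G : SimpleGraph V) : ℕ :=
  {q : ℝ | IsMainQEigenvalue G q}.ncard

/-- `G` contains an induced copy of `H`. -/
def HasInducedCopy {α β : Type*} (H : SimpleGraph α) (G : SimpleGraph β) : Prop :=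
  ∃ f : α ↪ β, ∀ a b : α, H.Adj a b ↔ G.Adj (f a) (f b)

/-- A cograph is a `P₄`-free graph. -/
def IsCograph {V : Type*} (G : SimpleGraph V) : Prop :=
  ¬ HasInducedCopy (SimpleGraph.pathGraph 4) G

/-- A quasi-threshold graph is a `{P₄, C₄}`-free graph. -/
def IsQuasiThreshold {V : Type*} (G : SimpleGraph V) : Prop :=
  ¬ HasInducedCopy (SimpleGraph.pathGraph 4) G ∧
  ¬ HasInducedCopy (SimpleGraph.cycleGraph 4) G

/-- A chordal graph: no induced cycle of length at least 4. -/
def IsChordal {V : Type*} (G : SimpleGraph V) : Prop :=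
  ∀ n : ℕ, 4 ≤ n → ¬ HasInducedCopy (SimpleGraph.cycleGraph n) G

/-- The join `G ⊕ H` of two vertex-disjoint graphs. -/
def graphJoin {V W : Type*} (G : SimpleGraph V) (H : SimpleGraph W) :
    SimpleGraph (V ⊕ W) where
  Adj x y :=
    match x, y with
    | Sum.inl a, Sum.inl b => G.Adj a b
    | Sum.inr a, Sum.inr b => H.Adj a b
    | Sum.inl _, Sum.inr _ => True
    | Sum.inr _, Sum.inl _ => True
  symm := by
    constructor
    rintro (a | a) (b | b) h
    · exact G.symm.symm _ _ h
    · trivial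
    · trivial
    · exact H.symm.symm _ _ h
  loopless := by
    constructor
    rintro (a | a) h
    · exact G.loopless.irrefl a h
    · exact H.loopless.irrefl a h

/-- The disjoint union `G ∪ H` of two vertex-disjoint graphs. -/
def disjUnionGraph {V W : Type*} (G : SimpleGraph V) (H : SimpleGraph W) :
    SimpleGraph (V ⊕ W) where
  Adj x y :=
    match x, y with
    | Sum.inl a, Sum.inl b => G.Adj a b
    | Sum.inr a, Sum.inr b => H.Adj a b
    | _, _ => False
  symm := by
    constructor
    rintro (a | a) (b | b) h
    · exact G.symm.symm _ _ h
    · exact h.elim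
    · exact h.elim
    · exact H.symm.symm _ _ h
  loopless := by
    constructor
    rintro (a | a) h
    · exact G.loopless.irrefl a h
    · exact H.loopless.irrefl a h

/-- `tK_a`: the disjoint union of `t` copies of the complete graph `K_a`. -/
def copiesComplete (t a : ℕ) : SimpleGraph (Fin t × Fin a) where
  Adj x y := x.1 = y.1 ∧ x.2 ≠ y.2
  symm := ⟨fun _ _ ⟨h1, h2⟩ => ⟨h1.symm, h2.symm⟩⟩
  loopless := ⟨fun _ ⟨_, h⟩ => h rfl⟩

/-- The disjoint union `a₁ K_{n₁} ∪ ⋯ ∪ a_p K_{n_p}`: for each `i : Fin p`,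
`a i` copies of the complete graph on `n i` vertices. Two vertices are adjacent
iff they lie in the same copy of the same complete graph and are distinct. -/
def satellites (p : ℕ) (a n : Fin p → ℕ) :
    SimpleGraph ((i : Fin p) × (Fin (a i) × Fin (n i))) where
  Adj x y := x.1 = y.1 ∧ HEq x.2.1 y.2.1 ∧ ¬ HEq x.2.2 y.2.2
  symm := ⟨fun _ _ ⟨h1, h2, h3⟩ => ⟨h1.symm, h2.symm, fun h => h3 h.symm⟩⟩
  loopless := ⟨fun _ ⟨_, _, h3⟩ => h3 HEq.rfl⟩

/-- The twin relation: `u ∼ v` iff `u = v`, or `N(u) = N(v)`, or `N[u] = N[v]`. -/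
def TwinRel {V : Type*} (G : SimpleGraph V) (u v : V) : Prop :=
  u = v ∨ G.neighborSet u = G.neighborSet v ∨
    insert u (G.neighborSet u) = insert v (G.neighborSet v)

lemma sl_symm {V : Type*} [Fintype V] (G : SimpleGraph V) :
    (signlessLaplacian G).transpose = signlessLaplacian G := by
  classical
  unfold signlessLaplacian
  rw [Matrix.transpose_add, Matrix.diagonal_transpose, SimpleGraph.transpose_adjMatrix]

open Classical in
lemma sl_apply {V : Type*} [Fintype V] (G : SimpleGraph V) (f : V → ℝ) (u : V) :
    (signlessLaplacian G).mulVec f u = ∑ w ∈ (G.neighborSet u).toFinset, (f u + f w) := by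
  have h1 : (signlessLaplacian G).mulVec f u
      = (G.degree u : ℝ) * f u + ∑ w ∈ G.neighborFinset u, f w := by
    unfold signlessLaplacian
    rw [Matrix.add_mulVec, Pi.add_apply, SimpleGraph.adjMatrix_mulVec_apply,
      Matrix.mulVec_diagonal]
  rw [h1, Finset.sum_add_distrib, Finset.sum_const, nsmul_eq_mul]
  congr!

/-- functions constant on twin classes -/
def twinConst {V : Type*} (G : SimpleGraph V) : Submodule ℝ (V → ℝ) where
  carrier := {f | ∀ u v, TwinRel G u v → f u = f v}
  add_mem' := by
    intro a b ha hb u v h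
    simp [ha u v h, hb u v h]
  zero_mem' := by intro u v _; rfl
  smul_mem' := by
    intro c a ha u v h
    simp [ha u v h]

lemma twinConst_inv {V : Type*} [Fintype V] (G : SimpleGraph V) (f : V → ℝ)
    (hf : f ∈ twinConst G) : (signlessLaplacian G).mulVec f ∈ twinConst G := by
  classical
  intro u v h
  have hfe : f u = f v := hf u v h
  rw [sl_apply, sl_apply, hfe]
  rcases h with h | h | h
  · subst h; rfl
  · congr! 1
    ext w; simp only [Set.mem_toFinset]; rw [h]
  · have key : ∀ z : V, ∑ w ∈ (insert z (G.neighborSet z)).toFinset, (f v + f w)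
        = (f v + f z) + ∑ w ∈ (G.neighborSet z).toFinset, (f v + f w) := by
      intro z
      rw [Set.toFinset_insert, Finset.sum_insert]
      simp
    have e : ∑ w ∈ (insert u (G.neighborSet u)).toFinset, (f v + f w)
        = ∑ w ∈ (insert v (G.neighborSet v)).toFinset, (f v + f w) := by
      congr! 1
      ext w; simp only [Set.mem_toFinset]; rw [h]
    have k1 := key u
    have k2 := key v
    rw [hfe] at k1
    linarith

lemma twinConst_finrank {V : Type*} [Fintype V] (G : SimpleGraph V) :
    Module.finrank ℝ (twinConst G) ≤
      {C : Set V | ∃ u : V, C = {v | TwinRel G u v}}.ncard := by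
  classical
  set S := {C : Set V | ∃ u : V, C = {v | TwinRel G u v}} with hS
  have hne : ∀ C : S, ∃ v : V, v ∈ C.1 := by
    rintro ⟨C, u, rfl⟩
    exact ⟨u, Or.inl rfl⟩
  choose rep hrep using hne
  let L : twinConst G →ₗ[ℝ] (S → ℝ) :=
    (LinearMap.funLeft ℝ ℝ rep).comp (twinConst G).subtype
  have hL : Function.Injective L := by
    intro f g hfg
    ext v
    let C : S := ⟨{w | TwinRel G v w}, v, rfl⟩
    have h1 : TwinRel G v (rep C) := hrep C
    have h2 : f.1 (rep C) = g.1 (rep C) := congrFun hfg C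
    rw [f.2 _ _ h1, g.2 _ _ h1, h2]
  have := LinearMap.finrank_le_finrank_of_injective hL
  rw [Module.finrank_fintype_fun_eq_card] at this
  rw [← Nat.card_coe_set_eq, Nat.card_eq_fintype_card]
  exact this

theorem cograph_main_count_le_twin_classes
    {V : Type*} [Fintype V] (G : SimpleGraph V) (hcog : IsCograph G)
    (r : ℕ)
    (hr : {C : Set V | ∃ u : V, C = {v | TwinRel G u v}}.ncard = r) :
    mainQCount G ≤ r := by
  classical
  rw [← hr]
  refine le_trans ?_ (twinConst_finrank G)
  rw [← Subspace.dual_finrank_eq (K := ℝ)]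
  let T : Module.End ℝ (twinConst G) :=
    (Matrix.mulVecLin (signlessLaplacian G)).restrict (fun f hf => twinConst_inv G f hf)
  let D : Module.End ℝ (Module.Dual ℝ (twinConst G)) := Module.Dual.transpose (R := ℝ) T
  unfold mainQCount
  set M := {q : ℝ | IsMainQEigenvalue G q} with hM
  have hx : ∀ q : M, ∃ x : V → ℝ, (signlessLaplacian G).mulVec x = q.1 • x ∧ (∑ v, x v) ≠ 0 :=
    fun q => q.2
  choose x hx1 hx2 using hx
  let φ : M → Module.Dual ℝ (twinConst G) := fun q =>
    (dotProductBilin ℝ ℝ (x q)).comp (twinConst G).subtype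
  have hφ : ∀ q (f : twinConst G), φ q f = x q ⬝ᵥ f.1 := fun q f => rfl
  have hli : LinearIndependent ℝ φ := by
    refine Module.End.eigenvectors_linearIndependent' D (fun q : M => q.1)
      Subtype.val_injective φ ?_
    intro q
    rw [Module.End.hasEigenvector_iff, Module.End.mem_eigenspace_iff]
    constructor
    · ext f
      change x q ⬝ᵥ (signlessLaplacian G).mulVec f.1 = q.1 * (x q ⬝ᵥ f.1)
      rw [Matrix.dotProduct_mulVec, ← Matrix.mulVec_transpose, sl_symm, hx1, smul_dotProduct,
        smul_eq_mul]
    · intro h0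
      apply hx2 q
      have := hφ q ⟨fun _ => 1, fun _ _ _ => rfl⟩
      rw [h0] at this
      simpa [dotProduct] using this.symm
  have : Finite M := hli.finite
  have := Fintype.ofFinite M
  rw [← Nat.card_coe_set_eq, Nat.card_eq_fintype_card]
  exact hli.fintype_card_le_finrank
end

section
/- Let G = K_{n_0} ⊕ (a_1 K_{n_1} ∪ a_2 K_{n_2} ∪ … ∪ a_p K_{n_p}) be a generalized core-satellite graph, where p, a_1, …, a_p, n_0, n_1, …, n_p ≥ 1 are integers with n_i ≠ n_j for i ≠ j, and a_1 + … + a_p ≥ 2. Then G has exactly two main Q-eigenvalues if and only if either (p = 2 and a_1 = a_2 = 1) — i.e., G has exactly two satellites of different orders — or (p = 1 and a_1 ≥ 2) — i.e., G has two or more satellites, all of the same order. -/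
open SimpleGraph

open Classical in
theorem cs_mulVec {V : Type*} [Fintype V] (G : SimpleGraph V) (x : V → ℝ) (v : V) :
    (signlessLaplacian G).mulVec x v = ∑ w, if G.Adj v w then (x v + x w) else 0 := by
  unfold signlessLaplacian
  simp only [Matrix.add_mulVec, Pi.add_apply, Matrix.mulVec_diagonal]
  rw [SimpleGraph.adjMatrix_mulVec_apply]
  rw [← Finset.sum_filter, Finset.sum_add_distrib, Finset.sum_const, nsmul_eq_mul]
  rw [← SimpleGraph.card_neighborFinset_eq_degree]
  congr 1
  · congr 3
    ext w
    simp
  · apply Finset.sum_congr _ (fun _ _ => rfl)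
    ext w
    simp

theorem cs_core (p n₀ : ℕ) (a n : Fin p → ℕ)
    (x : Fin n₀ ⊕ ((i : Fin p) × (Fin (a i) × Fin (n i))) → ℝ) (u : Fin n₀) :
    (signlessLaplacian (graphJoin (⊤ : SimpleGraph (Fin n₀)) (satellites p a n))).mulVec x (Sum.inl u)
      = ((n₀ : ℝ) + ∑ i, (a i : ℝ) * n i - 2) * x (Sum.inl u) + ∑ v, x v := by
  classical
  rw [cs_mulVec]
  have h : ∀ w, (if (graphJoin (⊤ : SimpleGraph (Fin n₀)) (satellites p a n)).Adj (Sum.inl u) w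
      then (x (Sum.inl u) + x w) else 0) =
      (x (Sum.inl u) + x w) - if w = Sum.inl u then 2 * x (Sum.inl u) else 0 := by
    rintro (w | w)
    · by_cases hw : w = u
      · subst hw
        simp [graphJoin]; ring
      · have : ¬ u = w := fun h => hw h.symm
        simp [graphJoin, hw, this]
    · simp [graphJoin]
  simp only [h, Finset.sum_sub_distrib, Finset.sum_add_distrib, Finset.sum_const, Finset.card_univ,
    nsmul_eq_mul, Finset.sum_ite_eq', Finset.mem_univ, if_true]
  simp [Fintype.card_sum, Fintype.card_sigma]
  ring

theorem cs_sat (p n₀ : ℕ) (a n : Fin p → ℕ)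
    (x : Fin n₀ ⊕ ((i : Fin p) × (Fin (a i) × Fin (n i))) → ℝ) (i : Fin p) (k : Fin (a i))
    (l : Fin (n i)) :
    (signlessLaplacian (graphJoin (⊤ : SimpleGraph (Fin n₀)) (satellites p a n))).mulVec x
      (Sum.inr ⟨i, k, l⟩)
      = ((n₀ : ℝ) + n i - 2) * x (Sum.inr ⟨i, k, l⟩) + ∑ u, x (Sum.inl u)
        + ∑ m, x (Sum.inr ⟨i, k, m⟩) := by
  classical
  rw [cs_mulVec, Fintype.sum_sum_type, Fintype.sum_sigma]
  rw [Fintype.sum_eq_single i]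
  · rw [Fintype.sum_prod_type, Fintype.sum_eq_single k]
    · have h : ∀ m, (if (graphJoin (⊤ : SimpleGraph (Fin n₀)) (satellites p a n)).Adj
          (Sum.inr ⟨i, k, l⟩) (Sum.inr ⟨i, k, m⟩)
          then (x (Sum.inr ⟨i, k, l⟩) + x (Sum.inr ⟨i, k, m⟩)) else 0) =
          (x (Sum.inr ⟨i, k, l⟩) + x (Sum.inr ⟨i, k, m⟩)) -
            if m = l then 2 * x (Sum.inr ⟨i, k, l⟩) else 0 := by
        intro m
        by_cases hw : m = l
        · subst hw
          simp [graphJoin, satellites]; ring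
        · have : ¬ l = m := fun h => hw h.symm
          simp [graphJoin, satellites, hw, this]
      simp only [h]
      simp [graphJoin, Finset.sum_add_distrib]
      ring
    · intro k' hk
      apply Finset.sum_eq_zero
      intro m _
      rw [if_neg]
      intro h
      simp [graphJoin, satellites] at h
      exact hk h.1.symm
  · intro j hj
    apply Finset.sum_eq_zero
    intro m _
    rw [if_neg]
    intro h
    simp [graphJoin, satellites] at h
    exact hj h.1.symm

theorem cs_main_iff (p n₀ : ℕ) (a n : Fin p → ℕ) (hp : 1 ≤ p) (hn₀ : 1 ≤ n₀)
    (ha : ∀ i, 1 ≤ a i) (hn : ∀ i, 1 ≤ n i) (q : ℝ) :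
    IsMainQEigenvalue (graphJoin (⊤ : SimpleGraph (Fin n₀)) (satellites p a n)) q ↔
      ((∀ i, q ≠ 2 * n i - 2 + n₀) ∧
        q - (2 * n₀ + ∑ i, (a i : ℝ) * n i - 2)
          = ∑ i, (a i : ℝ) * n i * n₀ / (q - (2 * n i - 2 + n₀))) ∧
      q ≠ n₀ + ∑ i, (a i : ℝ) * n i - 2 := by
  have hn0 : (n₀ : ℝ) ≠ 0 := by positivity
  constructor
  · rintro ⟨x, hx, hs⟩
    set s := ∑ v, x v with hsdef
    set M := ∑ i, (a i : ℝ) * n i with hM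
    have hc : ∀ u, (q - (n₀ + M - 2)) * x (Sum.inl u) = s := by
      intro u
      have := congrFun hx (Sum.inl u)
      rw [cs_core] at this
      simp only [Pi.smul_apply, smul_eq_mul] at this
      linarith
    have hq : q - (n₀ + M - 2) ≠ 0 := by
      intro h
      have := hc ⟨0, hn₀⟩
      rw [h, zero_mul] at this
      exact hs this.symm
    obtain ⟨t, ht⟩ : ∃ t, t = s / (q - (n₀ + M - 2)) := ⟨_, rfl⟩
    have hst : s = (q - (n₀ + M - 2)) * t := by rw [ht]; field_simp
    have ht0 : t ≠ 0 := by rintro rfl; simp at hst; exact hs hst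
    have hxt : ∀ u, x (Sum.inl u) = t := by
      intro u
      apply mul_left_cancel₀ hq
      rw [hc, hst]
    have hX : ∀ i k, (q - (2 * n i - 2 + n₀)) * ∑ m, x (Sum.inr ⟨i, k, m⟩) = n i * n₀ * t := by
      intro i k
      have h1 : ∀ l, q * x (Sum.inr ⟨i, k, l⟩) = ((n₀ : ℝ) + n i - 2) * x (Sum.inr ⟨i, k, l⟩)
          + n₀ * t + ∑ m, x (Sum.inr ⟨i, k, m⟩) := by
        intro l
        have := congrFun hx (Sum.inr ⟨i, k, l⟩)
        rw [cs_sat] at this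
        simp only [Pi.smul_apply, smul_eq_mul, hxt] at this
        simp at this
        linarith
      have h2 := Finset.sum_congr (rfl : (Finset.univ : Finset (Fin (n i))) = _) (fun l _ => h1 l)
      simp only [Finset.sum_add_distrib, ← Finset.mul_sum, Finset.sum_const, Finset.card_univ,
        Fintype.card_fin, nsmul_eq_mul] at h2
      linarith
    have hqc : ∀ i, q - (2 * n i - 2 + n₀) ≠ 0 := by
      intro i h
      have := hX i ⟨0, ha i⟩
      rw [h, zero_mul] at this
      have h3 : (n i : ℝ) ≠ 0 := by have := hn i; positivity
      exact (mul_ne_zero (mul_ne_zero h3 hn0) ht0) this.symm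
    refine ⟨⟨fun i h => hqc i (by linarith), ?_⟩, fun h => hq (by linarith)⟩
    have hsum : s = n₀ * t + ∑ i, (a i : ℝ) * n i * n₀ / (q - (2 * n i - 2 + n₀)) * t := by
      rw [hsdef, Fintype.sum_sum_type, Fintype.sum_sigma]
      congr 1
      · simp [hxt]
      · apply Finset.sum_congr rfl
        intro i _
        rw [Fintype.sum_prod_type]
        have : ∀ k, ∑ m, x (Sum.inr ⟨i, k, m⟩) = n i * n₀ * t / (q - (2 * n i - 2 + n₀)) := by
          intro k
          rw [eq_div_iff (hqc i), ← hX i k]; ring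
        simp only [this]
        simp; ring
    rw [← Finset.sum_mul] at hsum
    apply mul_right_cancel₀ ht0
    linarith
  · rintro ⟨⟨h1, h2⟩, h3⟩
    have hqc : ∀ i, q - (2 * n i - 2 + n₀) ≠ 0 := fun i => sub_ne_zero.mpr (h1 i)
    let x : Fin n₀ ⊕ ((i : Fin p) × (Fin (a i) × Fin (n i))) → ℝ :=
      Sum.elim (fun _ => 1) (fun y => n₀ / (q - (2 * n y.1 - 2 + n₀)))
    have hsum : ∑ v, x v = q - (n₀ + ∑ i, (a i : ℝ) * n i - 2) := by
      rw [Fintype.sum_sum_type, Fintype.sum_sigma]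
      simp only [x, Sum.elim_inl, Sum.elim_inr]
      have : ∑ i : Fin p, ∑ _y : Fin (a i) × Fin (n i), (n₀ : ℝ) / (q - (2 * n i - 2 + n₀)) =
         ∑ i, (a i : ℝ) * n i * n₀ / (q - (2 * n i - 2 + n₀)) := by
        apply Finset.sum_congr rfl
        intro i _
        simp; ring
      rw [this, ← h2]
      simp; ring
    refine ⟨x, ?_, ?_⟩
    · ext v
      rcases v with u | ⟨i, k, l⟩
      · rw [cs_core, hsum]
        simp [x]
      · rw [cs_sat]
        have hz : (n₀ : ℝ) / (q - (2 * n i - 2 + n₀)) * (q - (2 * n i - 2 + n₀)) = n₀ :=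
          div_mul_cancel₀ _ (hqc i)
        simp only [x, Sum.elim_inl, Sum.elim_inr, Pi.smul_apply, smul_eq_mul, Finset.sum_const,
          Finset.card_univ, Fintype.card_fin, nsmul_eq_mul, mul_one]
        linear_combination (-1) * hz
    · rw [hsum]; exact sub_ne_zero.mpr h3

theorem cs_arrow (p : ℕ) (d : ℝ) (b c : Fin p → ℝ) (hb : ∀ i, b i ≠ 0)
    (hc : Function.Injective c) :
    {q : ℝ | (∀ i, q ≠ c i) ∧ q - d = ∑ i, b i ^ 2 / (q - c i)}.ncard = p + 1 := by
  classical
  let B : Matrix (Option (Fin p)) (Option (Fin p)) ℝ := fun i j =>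
    match i, j with
    | none, none => d
    | none, some j => b j
    | some i, none => b i
    | some i, some j => if i = j then c i else 0
  have hB : B.IsHermitian := by
    ext i j
    rw [Matrix.conjTranspose_apply, star_trivial]
    rcases i with _ | i <;> rcases j with _ | j <;> simp only [B]
    by_cases h : i = j
    · rw [h]
    · rw [if_neg h, if_neg (Ne.symm h)]
  have hn : ∀ y : Option (Fin p) → ℝ, B.mulVec y none = d * y none + ∑ i, b i * y (some i) := by
    intro y
    simp [Matrix.mulVec, dotProduct, Fintype.sum_option, B]
  have hs : ∀ (y : Option (Fin p) → ℝ) i, B.mulVec y (some i) = b i * y none + c i * y (some i) := by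
    intro y i
    simp [Matrix.mulVec, dotProduct, Fintype.sum_option, B]
  -- key
  have key : ∀ (q : ℝ) (y : Option (Fin p) → ℝ), B.mulVec y = q • y → y none = 0 → y = 0 := by
    intro q y hy h0
    have e1 : ∑ i, b i * y (some i) = 0 := by
      have := congrFun hy none
      rw [hn] at this
      simpa [h0] using this
    have e2 : ∀ i, (q - c i) * y (some i) = 0 := by
      intro i
      have := congrFun hy (some i)
      rw [hs] at this
      simp only [h0, Pi.smul_apply, smul_eq_mul] at this
      linarith
    by_contra hne
    obtain ⟨j, hj⟩ : ∃ j, y (some j) ≠ 0 := by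
      by_contra hall
      push Not at hall
      apply hne
      ext o
      rcases o with _ | o
      · exact h0
      · exact hall o
    have hqj : q = c j := by
      have := (mul_eq_zero.mp (e2 j)).resolve_right hj
      linarith
    rw [Fintype.sum_eq_single j] at e1
    · exact (mul_ne_zero (hb j) hj) e1
    · intro i hi
      have : q - c i ≠ 0 := by
        rw [hqj]
        exact sub_ne_zero.mpr (fun h => hi (hc h).symm)
      rw [(mul_eq_zero.mp (e2 i)).resolve_left this, mul_zero]
  have hev : ∀ j, B.mulVec (hB.eigenvectorBasis j).ofLp = hB.eigenvalues j • (hB.eigenvectorBasis j).ofLp :=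
    fun j => hB.mulVec_eigenvectorBasis j
  have hne : ∀ j, (hB.eigenvectorBasis j).ofLp ≠ 0 := by
    intro j h
    have h1 := hB.eigenvectorBasis.orthonormal.ne_zero j
    apply h1
    ext o
    exact congrFun h o
  have hinj : Function.Injective hB.eigenvalues := by
    intro i j hij
    by_contra hne'
    have hi0 : (hB.eigenvectorBasis i).ofLp none ≠ 0 := fun h => hne i (key _ _ (hev i) h)
    set u := hB.eigenvectorBasis i with hu
    set v := hB.eigenvectorBasis j with hv
    have h0 : (u.ofLp none) • v.ofLp - (v.ofLp none) • u.ofLp = 0 := by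
      apply key (hB.eigenvalues i)
      · rw [Matrix.mulVec_sub, Matrix.mulVec_smul, Matrix.mulVec_smul, hev i, hev j, ← hij]
        ext o
        simp [u, v]
        ring
      · simp; ring
    have h1 : (u.ofLp none) • v - (v.ofLp none) • u = 0 := by
      ext o
      exact congrFun h0 o
    have h2 : inner ℝ v ((u.ofLp none) • v - (v.ofLp none) • u) = 0 := by rw [h1]; simp
    rw [inner_sub_right, inner_smul_right, inner_smul_right, real_inner_self_eq_norm_sq,
      hB.eigenvectorBasis.orthonormal.1 j, hB.eigenvectorBasis.orthonormal.2 (Ne.symm hne')] at h2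
    simp at h2
    exact hi0 h2
  have hset : {q : ℝ | (∀ i, q ≠ c i) ∧ q - d = ∑ i, b i ^ 2 / (q - c i)} =
      Set.range hB.eigenvalues := by
    ext q
    constructor
    · rintro ⟨h1, h2⟩
      have hqc : ∀ i, q - c i ≠ 0 := fun i => sub_ne_zero.mpr (h1 i)
      rw [← hB.spectrum_real_eq_range_eigenvalues, ← Matrix.spectrum_toLin',
        ← Module.End.hasEigenvalue_iff_mem_spectrum]
      let y : Option (Fin p) → ℝ := fun o => match o with
        | none => 1
        | some i => b i / (q - c i)
      apply Module.End.hasEigenvalue_of_hasEigenvector (x := y)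
      rw [Module.End.hasEigenvector_iff, Module.End.mem_eigenspace_iff]
      constructor
      · rw [Matrix.toLin'_apply]
        ext o
        rcases o with _ | i
        · rw [hn]
          simp [y]
          have : ∑ i, b i * (b i / (q - c i)) = q - d := by
            rw [h2]; apply Finset.sum_congr rfl; intro i _; ring
          rw [this]; ring
        · rw [hs]
          have := hqc i
          simp [y]
          field_simp
          ring
      · intro h
        have := congrFun h none
        simp [y] at this
    · rintro ⟨j, rfl⟩
      set q := hB.eigenvalues j
      set y := (hB.eigenvectorBasis j).ofLp
      have hy : B.mulVec y = q • y := hev j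
      have hy0 : y none ≠ 0 := fun h => hne j (key _ _ (hev j) h)
      have e2 : ∀ i, (q - c i) * y (some i) = b i * y none := by
        intro i
        have := congrFun hy (some i)
        rw [hs] at this
        simp at this
        linarith
      have hqc : ∀ i, q - c i ≠ 0 := by
        intro i h
        have := e2 i
        rw [h, zero_mul] at this
        exact mul_ne_zero (hb i) hy0 this.symm
      refine ⟨fun i => sub_ne_zero.mp (hqc i), ?_⟩
      have e1 := congrFun hy none
      rw [hn] at e1
      simp at e1
      apply mul_right_cancel₀ hy0
      rw [Finset.sum_mul, sub_mul, ← e1, add_sub_cancel_left]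
      apply Finset.sum_congr rfl
      intro i _
      have h1 : y (some i) = b i * y none / (q - c i) := by
        rw [eq_div_iff (hqc i), ← e2 i]; ring
      rw [h1]; ring
  rw [hset, ← Set.image_univ, Set.ncard_image_of_injective _ hinj, Set.ncard_univ]
  simp

/-- The value `N - 2` as a root of the secular equation. -/
theorem cs_root (p : ℕ) (a n : Fin p → ℕ)
    (ha : ∀ i, 1 ≤ a i) (hn : ∀ i, 1 ≤ n i)
    (hsat : 2 ≤ ∑ i, a i) (M : ℝ) (hM : M = ∑ i, (a i : ℝ) * n i)
    (h1 : ∀ i, M - 2 * n i ≠ 0) (h2 : ∑ i, (a i : ℝ) * n i / (M - 2 * n i) = -1) :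
    p = 2 ∧ ∀ i, a i = 1 := by
  obtain ⟨i, hi⟩ : ∃ i, M - 2 * n i < 0 := by
    by_contra h
    push Not at h
    have : 0 ≤ ∑ i, (a i : ℝ) * n i / (M - 2 * n i) :=
      Finset.sum_nonneg (fun i _ => div_nonneg (by positivity) (h i))
    linarith
  have hsplit : ∀ f : Fin p → ℝ, ∑ j, f j = f i + ∑ j ∈ Finset.univ.erase i, f j := fun f =>
    (Finset.add_sum_erase _ f (Finset.mem_univ i)).symm
  set R := ∑ j ∈ Finset.univ.erase i, (a j : ℝ) * n j with hR
  have hMR : M = a i * n i + R := by rw [hM, hsplit]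
  have hR0 : 0 ≤ R := Finset.sum_nonneg (fun j _ => by positivity)
  have hni : (1 : ℝ) ≤ n i := by exact_mod_cast hn i
  have hai : a i = 1 := by
    by_contra hne
    have : 2 ≤ a i := by have := ha i; omega
    have : (2 : ℝ) ≤ a i := by exact_mod_cast this
    nlinarith
  have hmR : R < n i := by rw [hMR, hai] at hi; push_cast at hi; linarith
  have hjR : ∀ j ∈ Finset.univ.erase i, (a j : ℝ) * n j ≤ R := fun j hj =>
    Finset.single_le_sum (f := fun j => (a j : ℝ) * n j) (fun j _ => by positivity) hj
  have hnR : ∀ j, (n j : ℝ) ≤ a j * n j := fun j => by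
    have : (1 : ℝ) ≤ a j := by exact_mod_cast ha j
    have : (0 : ℝ) ≤ n j := by positivity
    nlinarith
  rw [hsplit, hMR, hai] at h2
  push_cast at h2
  have hd : (0 : ℝ) < n i - R := by linarith
  have e : ∑ j ∈ Finset.univ.erase i, (a j : ℝ) * n j / (1 * n i + R - 2 * n j) =
      ∑ j ∈ Finset.univ.erase i, (a j : ℝ) * n j / (n i - R) := by
    rw [← Finset.sum_div, ← hR]
    have : (1 * (n i : ℝ)) / (1 * n i + R - 2 * n i) = - (n i / (n i - R)) := by
      rw [← div_neg]; congr 1 <;> ring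
    rw [this] at h2
    have h3 : R / (n i - R) = n i / (n i - R) - 1 := by field_simp; ring
    linarith
  have e' := (Finset.sum_eq_sum_iff_of_le (fun j hj => by
    have := hjR j hj
    have := hnR j
    apply div_le_div_of_nonneg_left (by positivity) hd (by linarith))).mp e
  have e2 : ∀ j ∈ Finset.univ.erase i, (n j : ℝ) = R := by
    intro j hj
    have h3 := e' j hj
    have h4 := hjR j hj
    have h5 := hnR j
    have h6 : (1 : ℝ) ≤ n j := by exact_mod_cast hn j
    rw [div_eq_div_iff (by linarith) (by linarith)] at h3
    have := mul_left_cancel₀ (by linarith) h3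
    linarith
  have e3 : ∀ j ∈ Finset.univ.erase i, a j = 1 := by
    intro j hj
    have h4 := hjR j hj
    have h6 : (1 : ℝ) ≤ n j := by exact_mod_cast hn j
    rw [← e2 j hj] at h4
    have : (a j : ℝ) ≤ 1 := by nlinarith
    have : a j ≤ 1 := by exact_mod_cast this
    have := ha j
    omega
  have hall : ∀ j, a j = 1 := fun j => by
    by_cases h : j = i
    · rw [h, hai]
    · exact e3 j (by simp [h])
  refine ⟨?_, hall⟩
  simp [hall] at hsat
  have hcard : (Finset.univ.erase i).card = p - 1 := by simp
  obtain ⟨j, hj⟩ : (Finset.univ.erase i).Nonempty := by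
    rw [← Finset.card_pos, hcard]; omega
  have hj6 : (1 : ℝ) ≤ n j := by exact_mod_cast hn j
  have hR2 : R = ((p - 1 : ℕ) : ℝ) * R := by
    conv_lhs => rw [hR]
    rw [Finset.sum_congr rfl (fun j hj => show (a j : ℝ) * n j = R by rw [e2 j hj, hall]; simp)]
    rw [Finset.sum_const, hcard, nsmul_eq_mul]
  have hRpos : 0 < R := by rw [← e2 j hj]; linarith
  have : ((p - 1 : ℕ) : ℝ) = 1 := by
    apply mul_right_cancel₀ hRpos.ne'
    linarith
  have : p - 1 = 1 := by exact_mod_cast this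
  omega

theorem coreSatellite_two_main_iff
    (p n₀ : ℕ) (a n : Fin p → ℕ) (hp : 1 ≤ p) (hn₀ : 1 ≤ n₀)
    (ha : ∀ i, 1 ≤ a i) (hn : ∀ i, 1 ≤ n i) (hninj : Function.Injective n)
    (hsat : 2 ≤ ∑ i, a i) :
    mainQCount (graphJoin (⊤ : SimpleGraph (Fin n₀)) (satellites p a n)) = 2 ↔
      ((p = 2 ∧ ∀ i, a i = 1) ∨ (p = 1 ∧ ∀ i, 2 ≤ a i)) := by
  have hn0 : (n₀ : ℝ) ≠ 0 := by positivity
  obtain ⟨S, hS⟩ : ∃ S : Set ℝ, S = {q : ℝ | (∀ i, q ≠ 2 * n i - 2 + n₀) ∧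
        q - (2 * n₀ + ∑ i, (a i : ℝ) * n i - 2)
          = ∑ i, (a i : ℝ) * n i * n₀ / (q - (2 * n i - 2 + n₀))} := ⟨_, rfl⟩
  obtain ⟨M, hM⟩ : ∃ M : ℝ, M = ∑ i, (a i : ℝ) * n i := ⟨_, rfl⟩
  have hcount : S.ncard = p + 1 := by
    rw [← cs_arrow p (2 * n₀ + ∑ i, (a i : ℝ) * n i - 2)
      (fun i => Real.sqrt ((a i : ℝ) * n i * n₀)) (fun i => 2 * n i - 2 + n₀), hS]
    · congr 1
      ext q
      simp only [Set.mem_setOf_eq]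
      have : ∀ i, Real.sqrt ((a i : ℝ) * n i * n₀) ^ 2 = (a i : ℝ) * n i * n₀ :=
        fun i => Real.sq_sqrt (by positivity)
      simp only [this]
    · intro i
      have := ha i
      have := hn i
      positivity
    · intro i j hij
      apply hninj
      have : (n i : ℝ) = n j := by simp at hij; exact_mod_cast hij
      exact_mod_cast this
  have hfin : S.Finite := Set.finite_of_ncard_ne_zero (by omega)
  have hmain : mainQCount (graphJoin (⊤ : SimpleGraph (Fin n₀)) (satellites p a n)) =
      (S \ {(n₀ : ℝ) + M - 2}).ncard := by
    unfold mainQCount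
    congr 1
    ext q
    rw [Set.mem_setOf_eq, cs_main_iff p n₀ a n hp hn₀ ha hn, hS, hM]
    rfl
  have hroot : (n₀ : ℝ) + M - 2 ∈ S ↔
      (∀ i, M - 2 * n i ≠ 0) ∧ ∑ i, (a i : ℝ) * n i / (M - 2 * n i) = -1 := by
    rw [hS, Set.mem_setOf_eq, ← hM]
    apply and_congr
    · apply forall_congr'
      intro i
      apply not_congr
      constructor <;> intro h <;> linarith
    · have : ∑ i, (a i : ℝ) * n i * n₀ / ((n₀ : ℝ) + M - 2 - (2 * n i - 2 + n₀)) =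
          (∑ i, (a i : ℝ) * n i / (M - 2 * n i)) * n₀ := by
        rw [Finset.sum_mul]
        apply Finset.sum_congr rfl
        intro i _
        rw [show (n₀ : ℝ) + M - 2 - (2 * n i - 2 + n₀) = M - 2 * n i by ring]
        ring
      rw [this]
      constructor
      · intro h
        apply mul_right_cancel₀ hn0
        linarith
      · intro h
        rw [h]; ring
  rw [hmain]
  by_cases hmem : (n₀ : ℝ) + M - 2 ∈ S
  · obtain ⟨r1, r2⟩ := hroot.mp hmem
    obtain ⟨hp2, ha1⟩ := cs_root p a n ha hn hsat M hM r1 r2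
    rw [Set.ncard_diff_singleton_of_mem hmem, hcount]
    constructor
    · intro _; exact Or.inl ⟨hp2, ha1⟩
    · intro _; omega
  · rw [Set.diff_singleton_eq_self hmem, hcount]
    constructor
    · intro h
      have h1 : p = 1 := by omega
      refine Or.inr ⟨h1, ?_⟩
      subst h1
      intro i
      rw [Fin.sum_univ_one] at hsat
      rw [Subsingleton.elim i 0]; exact hsat
    · rintro (⟨h1, h2⟩ | ⟨h1, _⟩)
      · exfalso
        apply hmem
        rw [hroot]
        subst h1
        have hne : n 0 ≠ n 1 := fun h => by simpa using hninj h
        have hne' : (n 0 : ℝ) ≠ n 1 := by exact_mod_cast hne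
        have hA : (n 0 : ℝ) - n 1 ≠ 0 := sub_ne_zero.mpr hne'
        have hB : (n 1 : ℝ) - n 0 ≠ 0 := sub_ne_zero.mpr hne'.symm
        have hM' : M = n 0 + n 1 := by rw [hM]; simp [h2]
        have e0 : M - 2 * n 0 = n 1 - n 0 := by rw [hM']; ring
        have e1 : M - 2 * n 1 = -(n 1 - n 0) := by rw [hM']; ring
        constructor
        · rw [Fin.forall_fin_two, e0, e1]
          exact ⟨hB, neg_ne_zero.mpr hB⟩
        · rw [Fin.sum_univ_two, e0, e1, h2, h2, div_neg]
          field_simp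
          push_cast
          ring
      · omega
end
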